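/- Let G be a finite group, c0, c1, m positive integers, b_x, M1, M2 ≥ 0, δ ∈ (0,1), and let σ, φ, ρ : ℝ → ℝ be 1-Lipschitz and positively homogeneous. Let Y be a measurable space, ℓ : ℝ × Y → ℝ measurable with |ℓ| ≤ 1 everywhere and t ↦ ℓ(t, y) 1-Lipschitz for every y ∈ Y, and let μ be a probability measure on (inputs) × Y which is supported on pairs (x,y) with ‖x‖ ≤ b_x. For inputs x let h_{u,w}(x) = Σ_{j∈Fin c1} u_j · φ( (1/|G|) Σ_{g∈G} ρ( σ( z_j^{w,x}(g) ) ) ). Then with probability at least 1−δ over an i.i.d. sample ((x_1,y_1),…,(x_m,y_m)) drawn from the m-fold product measure μ^m, simultaneously for all u with ‖u‖ ≤ M1 and all w with ‖w‖ ≤ M2: E_{(x,y)∼μ} ℓ(h_{u,w}(x), y) ≤ (1/m) Σ_{i=1}^m ℓ(h_{u,w}(x_i), y_i) + 2·b_x·M1·M2/√m + 4·√(2·log(4/δ)/m). -/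

import Mathlib

open Finset MeasureTheory

/-- Multi-channel group convolution pre-activation channel:
`z j g = ∑ i, ∑ h, w j i (g⁻¹ h) * x i h`. -/
noncomputable def gconvChannel {G : Type*} [Group G] [Fintype G] {c0 : ℕ}
    (w : Fin c0 → G → ℝ) (x : Fin c0 → G → ℝ) (g : G) : ℝ :=
  ∑ i : Fin c0, ∑ h : G, w i (g⁻¹ * h) * x i h

/-- One-hidden-layer group convolutional network with general pooling
`P ∘ z = φ ((1/|G|) ∑ g ρ (z g))` applied after the pointwise activation `σ`. -/
noncomputable def gpoolNet {G : Type*} [Group G] [Fintype G] {c0 c1 : ℕ}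
    (σ φ ρ : ℝ → ℝ) (u : Fin c1 → ℝ) (w : Fin c1 → Fin c0 → G → ℝ)
    (x : Fin c0 → G → ℝ) : ℝ :=
  ∑ j : Fin c1, u j *
    φ ((1 / (Fintype.card G : ℝ)) * ∑ g : G, ρ (σ (gconvChannel (w j) x g)))


/-! ### Rademacher signs -/

/-- The sign attached to a boolean. -/
noncomputable def sgB (b : Bool) : ℝ := if b then 1 else -1

lemma sgB_not (b : Bool) : sgB (!b) = - sgB b := by cases b <;> simp [sgB]

lemma sgB_mul_self (b : Bool) : sgB b * sgB b = 1 := by cases b <;> simp [sgB]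

lemma abs_sgB (b : Bool) : |sgB b| = 1 := by cases b <;> simp [sgB]

/-- Flip one coordinate. -/
def flipAt {ι : Type*} [DecidableEq ι] (i : ι) (ε : ι → Bool) : ι → Bool :=
  Function.update ε i (!(ε i))

lemma flipAt_invol {ι : Type*} [DecidableEq ι] (i : ι) :
    Function.Involutive (flipAt (ι := ι) i) := by
  intro ε
  funext j
  by_cases h : j = i
  · subst h; simp [flipAt]
  · simp [flipAt, h]

lemma flipAt_same {ι : Type*} [DecidableEq ι] (i : ι) (ε : ι → Bool) :
    flipAt i ε i = !(ε i) := by simp [flipAt]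

lemma flipAt_ne {ι : Type*} [DecidableEq ι] {i j : ι} (h : j ≠ i) (ε : ι → Bool) :
    flipAt i ε j = ε j := by simp [flipAt, h]

lemma sum_flipAt {ι : Type*} [Fintype ι] [DecidableEq ι] (i : ι) (F : (ι → Bool) → ℝ) :
    ∑ ε, F (flipAt i ε) = ∑ ε, F ε :=
  Equiv.sum_comp (flipAt_invol i).toPerm F

lemma sum_not {ι : Type*} [Fintype ι] [DecidableEq ι] (F : (ι → Bool) → ℝ) :
    ∑ ε : ι → Bool, F (fun i => !(ε i)) = ∑ ε, F ε := by
  have h : Function.Involutive (fun (ε : ι → Bool) => fun i => !(ε i)) := by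
    intro ε; funext i; simp
  exact Equiv.sum_comp h.toPerm F

lemma sum_le_sum_of_flip {ι : Type*} [Fintype ι] [DecidableEq ι] (i : ι)
    (F H : (ι → Bool) → ℝ)
    (h : ∀ ε, F ε + F (flipAt i ε) ≤ H ε + H (flipAt i ε)) : ∑ ε, F ε ≤ ∑ ε, H ε := by
  have h1 : ∑ ε, (F ε + F (flipAt i ε)) ≤ ∑ ε, (H ε + H (flipAt i ε)) :=
    Finset.sum_le_sum fun ε _ => h ε
  rw [Finset.sum_add_distrib, Finset.sum_add_distrib, sum_flipAt, sum_flipAt] at h1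
  linarith

lemma sum_sgB_mul {ι : Type*} [Fintype ι] [DecidableEq ι] (i j : ι) :
    ∑ ε : ι → Bool, sgB (ε i) * sgB (ε j) = if i = j then (2 : ℝ) ^ Fintype.card ι else 0 := by
  split_ifs with h
  · subst h
    simp [sgB_mul_self]
  · have := sum_flipAt i (fun ε : ι → Bool => sgB (ε i) * sgB (ε j))
    simp only [flipAt_same, flipAt_ne (Ne.symm h), sgB_not, neg_mul, Finset.sum_neg_distrib] at this
    linarith

lemma sum_sgB {ι : Type*} [Fintype ι] [DecidableEq ι] (i : ι) :
    ∑ ε : ι → Bool, sgB (ε i) = 0 := by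
  have := sum_flipAt i (fun ε : ι → Bool => sgB (ε i))
  simp only [flipAt_same, sgB_not, Finset.sum_neg_distrib] at this
  linarith

lemma sum_sgB_sq {ι : Type*} [Fintype ι] [DecidableEq ι] (c : ι → ℝ) :
    ∑ ε : ι → Bool, (∑ i, sgB (ε i) * c i) ^ 2 = 2 ^ Fintype.card ι * ∑ i, c i ^ 2 := by
  have h1 : ∀ ε : ι → Bool, (∑ i, sgB (ε i) * c i) ^ 2
      = ∑ i, ∑ j, (c i * c j) * (sgB (ε i) * sgB (ε j)) := by
    intro ε
    rw [sq, Finset.sum_mul_sum]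
    refine Finset.sum_congr rfl fun i _ => Finset.sum_congr rfl fun j _ => by ring
  simp_rw [h1]
  rw [Finset.sum_comm, Finset.mul_sum]
  refine Finset.sum_congr rfl fun i _ => ?_
  rw [Finset.sum_comm]
  simp_rw [← Finset.mul_sum, sum_sgB_mul]
  simp
  ring

/-- Cauchy-Schwarz for averages over signs. -/
lemma sum_signs_le_sqrt {ι : Type*} [Fintype ι] [DecidableEq ι] (F : (ι → Bool) → ℝ) (V : ℝ)
    (h : ∑ ε, F ε ^ 2 ≤ 2 ^ Fintype.card ι * V) :
    ∑ ε, F ε ≤ 2 ^ Fintype.card ι * Real.sqrt V := by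
  have h1 := sq_sum_le_card_mul_sum_sq (s := (Finset.univ : Finset (ι → Bool))) (f := F)
  have hc : ((Finset.univ : Finset (ι → Bool)).card : ℝ) = 2 ^ Fintype.card ι := by simp
  rw [hc] at h1
  have hp : (0 : ℝ) < 2 ^ Fintype.card ι := by positivity
  have h2 : (∑ ε, F ε) ^ 2 ≤ (2 ^ Fintype.card ι) ^ 2 * V := by nlinarith
  have h3 := Real.abs_le_sqrt h2
  rw [Real.sqrt_mul (by positivity), Real.sqrt_sq hp.le] at h3
  exact (le_abs_self _).trans h3

/-! ### Contraction -/

/-- Squared positive part. -/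
noncomputable def posq (x : ℝ) : ℝ := (max x 0) ^ 2

/-- Majorization property, satisfied by monotone convex functions. -/
def MajProp (Φ : ℝ → ℝ) : Prop :=
  ∀ P Q A B : ℝ, P + Q ≤ A + B → P ≤ max A B → Q ≤ max A B → Φ P + Φ Q ≤ Φ A + Φ B

lemma majProp_id : MajProp (fun x => x) := fun _ _ _ _ h _ _ => h

lemma posq_nonneg (x : ℝ) : 0 ≤ posq x := sq_nonneg _

lemma posq_mono : Monotone posq := fun _ _ h =>
  pow_le_pow_left₀ (le_max_right _ _) (max_le_max_right 0 h) 2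

lemma posq_le_sq (x : ℝ) : posq x ≤ x ^ 2 := by
  unfold posq
  rcases le_total x 0 with h | h
  · rw [max_eq_right h]; nlinarith [sq_nonneg x]
  · rw [max_eq_left h]

lemma posq_aux {P Q A B : ℝ} (h : P + Q ≤ A + B) (hBA : B ≤ A) (hQP : Q ≤ P)
    (hP : P ≤ A) : posq P + posq Q ≤ posq A + posq B := by
  by_cases hQB : Q ≤ B
  · exact add_le_add (posq_mono hP) (posq_mono hQB)
  push Not at hQB
  unfold posq
  rcases le_total P 0 with h1 | h1 <;> rcases le_total Q 0 with h2 | h2 <;>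
  rcases le_total A 0 with h3 | h3 <;> rcases le_total B 0 with h4 | h4 <;>
  simp only [max_eq_left, max_eq_right, h1, h2, h3, h4] <;>
  nlinarith

lemma majProp_posq : MajProp posq := by
  intro P Q A B h hP hQ
  rcases le_total A B with hAB | hAB <;> rcases le_total P Q with hPQ | hPQ
  · rw [max_eq_right hAB] at hP hQ
    have := posq_aux (P := Q) (Q := P) (A := B) (B := A) (by linarith) hAB hPQ hQ
    linarith
  · rw [max_eq_right hAB] at hP hQ
    have := posq_aux (P := P) (Q := Q) (A := B) (B := A) (by linarith) hAB hPQ hP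
    linarith
  · rw [max_eq_left hAB] at hP hQ
    have := posq_aux (P := Q) (Q := P) (A := A) (B := B) (by linarith) hAB hPQ hQ
    linarith
  · rw [max_eq_left hAB] at hP hQ
    exact posq_aux h hAB hPQ hP

lemma le_iSup_fin {T : Type*} [Finite T] (f : T → ℝ) (t : T) : f t ≤ ⨆ t, f t :=
  le_ciSup (Set.finite_range f).bddAbove t

lemma contraction_step {T : Type*} [Finite T] [Nonempty T] {Φ : ℝ → ℝ} (hΦ : MajProp Φ)
    (ψ : ℝ → ℝ) (hψ : ∀ x y, |ψ x - ψ y| ≤ |x - y|) (hψ0 : ψ 0 = 0) (c a : T → ℝ) :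
    Φ (⨆ t, (c t + ψ (a t))) + Φ (⨆ t, (c t - ψ (a t)))
      ≤ Φ (⨆ t, (c t + a t)) + Φ (⨆ t, (c t - a t)) := by
  obtain ⟨t1, h1⟩ := exists_eq_ciSup_of_finite (f := fun t => c t + ψ (a t))
  obtain ⟨t2, h2⟩ := exists_eq_ciSup_of_finite (f := fun t => c t - ψ (a t))
  rw [← h1, ← h2]
  have hA := le_iSup_fin (fun t => c t + a t)
  have hB := le_iSup_fin (fun t => c t - a t)
  set A := ⨆ t, (c t + a t)
  set B := ⨆ t, (c t - a t)
  have b1 : |ψ (a t1)| ≤ |a t1| := by simpa [hψ0] using hψ (a t1) 0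
  have b2 : |ψ (a t2)| ≤ |a t2| := by simpa [hψ0] using hψ (a t2) 0
  have b3 := hψ (a t1) (a t2)
  have hA1 := hA t1
  have hA2 := hA t2
  have hB1 := hB t1
  have hB2 := hB t2
  have b1' := abs_le.1 b1
  have b2' := abs_le.1 b2
  have b3' := abs_le.1 b3
  apply hΦ
  · rcases le_total (a t1) (a t2) with h | h
    · rw [abs_of_nonpos (by linarith : a t1 - a t2 ≤ 0)] at b3'
      linarith [b3'.2]
    · rw [abs_of_nonneg (by linarith : 0 ≤ a t1 - a t2)] at b3'
      linarith [b3'.2]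
  · rcases le_total (a t1) 0 with h | h
    · rw [abs_of_nonpos h] at b1'
      exact le_max_of_le_right (by linarith [b1'.2])
    · rw [abs_of_nonneg h] at b1'
      exact le_max_of_le_left (by linarith [b1'.2])
  · rcases le_total (a t2) 0 with h | h
    · rw [abs_of_nonpos h] at b2'
      exact le_max_of_le_right (by linarith [b2'.1])
    · rw [abs_of_nonneg h] at b2'
      exact le_max_of_le_left (by linarith [b2'.1])

lemma contraction_signs {ι T : Type*} [Fintype ι] [DecidableEq ι] [Finite T] [Nonempty T]
    {Φ : ℝ → ℝ} (hΦ : MajProp Φ)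
    (ψ : ι → ℝ → ℝ) (hψ : ∀ i x y, |ψ i x - ψ i y| ≤ |x - y|) (hψ0 : ∀ i, ψ i 0 = 0)
    (a : ι → T → ℝ) :
    ∑ ε : ι → Bool, Φ (⨆ t, ∑ i, sgB (ε i) * ψ i (a i t))
      ≤ ∑ ε : ι → Bool, Φ (⨆ t, ∑ i, sgB (ε i) * a i t) := by
  have key : ∀ s : Finset ι,
      ∑ ε : ι → Bool, Φ (⨆ t, ∑ i, sgB (ε i) * (if i ∈ s then ψ i (a i t) else a i t))
      ≤ ∑ ε : ι → Bool, Φ (⨆ t, ∑ i, sgB (ε i) * a i t) := by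
    intro s
    induction s using Finset.induction_on with
    | empty => simp
    | insert k s hk ih =>
      refine le_trans ?_ ih
      apply sum_le_sum_of_flip k
      intro ε
      have hsplit : ∀ (ε' : ι → Bool) (b : ι → ℝ), ∑ i, sgB (ε' i) * b i
          = (∑ i ∈ Finset.univ.erase k, sgB (ε' i) * b i) + sgB (ε' k) * b k := by
        intro ε' b
        rw [Finset.sum_erase_add _ _ (Finset.mem_univ k)]
      let c : T → ℝ := fun t => ∑ i ∈ Finset.univ.erase k,
        sgB (ε i) * (if i ∈ s then ψ i (a i t) else a i t)
      have c1 : ∀ t, ∑ i ∈ Finset.univ.erase k,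
          sgB (ε i) * (if i ∈ insert k s then ψ i (a i t) else a i t) = c t := by
        intro t
        refine Finset.sum_congr rfl fun i hi => ?_
        have : i ≠ k := Finset.ne_of_mem_erase hi
        simp [Finset.mem_insert, this]
      have c2 : ∀ t, ∑ i ∈ Finset.univ.erase k,
          sgB (flipAt k ε i) * (if i ∈ insert k s then ψ i (a i t) else a i t) = c t := by
        intro t
        rw [← c1]
        refine Finset.sum_congr rfl fun i hi => ?_
        rw [flipAt_ne (Finset.ne_of_mem_erase hi)]
      have c3 : ∀ t, ∑ i ∈ Finset.univ.erase k,
          sgB (flipAt k ε i) * (if i ∈ s then ψ i (a i t) else a i t) = c t := by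
        intro t
        refine Finset.sum_congr rfl fun i hi => ?_
        rw [flipAt_ne (Finset.ne_of_mem_erase hi)]
      have c4 : ∀ t, ∑ i ∈ Finset.univ.erase k,
          sgB (ε i) * (if i ∈ s then ψ i (a i t) else a i t) = c t := fun t => rfl
      simp_rw [hsplit, c1, c2, c3, c4, flipAt_same, sgB_not, Finset.mem_insert_self, if_true,
        if_neg hk]
      have hst := contraction_step hΦ (ψ k) (hψ k) (hψ0 k) c (a k)
      cases ε k
      · simp only [sgB, neg_mul, one_mul, Bool.false_eq_true, if_false, neg_neg, ← sub_eq_add_neg]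
        linarith
      · simp only [sgB, neg_mul, one_mul, if_true, ← sub_eq_add_neg]
        linarith
  simpa using key Finset.univ

/-! ### Rademacher complexity of the network class -/

/-- One pooled channel. -/
noncomputable def chanNet {G : Type*} [Group G] [Fintype G] {c0 : ℕ}
    (σ φ ρ : ℝ → ℝ) (w : Fin c0 → G → ℝ) (x : Fin c0 → G → ℝ) : ℝ :=
  φ ((1 / (Fintype.card G : ℝ)) * ∑ g : G, ρ (σ (gconvChannel w x g)))

lemma lip_abs {f : ℝ → ℝ} (hf : LipschitzWith 1 f) (x y : ℝ) : |f x - f y| ≤ |x - y| := by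
  have := hf.dist_le_mul x y
  simpa [Real.dist_eq] using this

lemma hom_zero {f : ℝ → ℝ} (hf : ∀ a t : ℝ, 0 ≤ a → f (a * t) = a * f t) : f 0 = 0 := by
  simpa using hf 0 0 le_rfl

lemma gconvChannel_shift {G : Type*} [Group G] [Fintype G] {c0 : ℕ}
    (w x : Fin c0 → G → ℝ) (g : G) :
    gconvChannel w x g = ∑ i, ∑ h, w i h * x i (g * h) := by
  unfold gconvChannel
  refine Finset.sum_congr rfl fun i _ => ?_
  rw [← Equiv.sum_comp (Equiv.mulLeft g)]
  simp

lemma gconvChannel_smul {G : Type*} [Group G] [Fintype G] {c0 : ℕ}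
    (r : ℝ) (w x : Fin c0 → G → ℝ) (g : G) :
    gconvChannel (fun i h => r * w i h) x g = r * gconvChannel w x g := by
  unfold gconvChannel
  simp_rw [Finset.mul_sum, mul_assoc]

lemma chanNet_smul {G : Type*} [Group G] [Fintype G] {c0 : ℕ}
    {σ φ ρ : ℝ → ℝ}
    (hσh : ∀ a t : ℝ, 0 ≤ a → σ (a * t) = a * σ t)
    (hφh : ∀ a t : ℝ, 0 ≤ a → φ (a * t) = a * φ t)
    (hρh : ∀ a t : ℝ, 0 ≤ a → ρ (a * t) = a * ρ t)
    (r : ℝ) (hr : 0 ≤ r) (w x : Fin c0 → G → ℝ) :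
    chanNet σ φ ρ (fun i h => r * w i h) x = r * chanNet σ φ ρ w x := by
  unfold chanNet
  simp_rw [gconvChannel_smul, hσh r _ hr, hρh r _ hr, ← Finset.mul_sum]
  rw [mul_left_comm, hφh r _ hr]

lemma sum_linear_le {G : Type*} [Group G] [Fintype G] {c0 : ℕ} {ι : Type*} [Fintype ι]
    (w : Fin c0 → G → ℝ) (hw : ∑ k, ∑ h, w k h ^ 2 ≤ 1) (s : ι → ℝ)
    (x : ι → Fin c0 → G → ℝ) (g : G) :
    (∑ i, s i * gconvChannel w (x i) g) ^ 2 ≤ ∑ k, ∑ h, (∑ i, s i * x i k (g * h)) ^ 2 := by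
  have h1 : ∑ i, s i * gconvChannel w (x i) g
      = ∑ p : Fin c0 × G, w p.1 p.2 * (∑ i, s i * x i p.1 (g * p.2)) := by
    simp_rw [gconvChannel_shift, Finset.mul_sum, Fintype.sum_prod_type]
    rw [Finset.sum_comm]
    refine Finset.sum_congr rfl fun k _ => ?_
    rw [Finset.sum_comm]
    refine Finset.sum_congr rfl fun h _ => Finset.sum_congr rfl fun i _ => by ring
  rw [h1]
  refine (Finset.sum_mul_sq_le_sq_mul_sq _ _ _).trans ?_
  simp only [Fintype.sum_prod_type]
  have : 0 ≤ ∑ k, ∑ h, (∑ i, s i * x i k (g * h)) ^ 2 := by positivity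
  nlinarith

lemma posq_iSup_avg {G T : Type*} [Fintype G] [Nonempty G] [Finite T] [Nonempty T]
    (F : G → T → ℝ) :
    posq (⨆ t, (1 / (Fintype.card G : ℝ)) * ∑ g, F g t)
      ≤ (1 / (Fintype.card G : ℝ)) * ∑ g, posq (⨆ t, F g t) := by
  have hc : (0 : ℝ) < Fintype.card G := by exact_mod_cast Fintype.card_pos
  have h1 : (⨆ t, (1 / (Fintype.card G : ℝ)) * ∑ g, F g t)
      ≤ (1 / (Fintype.card G : ℝ)) * ∑ g, max (⨆ t, F g t) 0 := by
    refine ciSup_le fun t => ?_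
    refine mul_le_mul_of_nonneg_left ?_ (by positivity)
    exact Finset.sum_le_sum fun g _ => le_max_of_le_left (le_iSup_fin (F g) t)
  have h0 : 0 ≤ (1 / (Fintype.card G : ℝ)) * ∑ g, max (⨆ t, F g t) 0 := by positivity
  have h2 := posq_mono h1
  refine h2.trans ?_
  refine (posq_le_sq _).trans ?_
  have h3 := sq_sum_le_card_mul_sum_sq (s := (Finset.univ : Finset G))
    (f := fun g => max (⨆ t, F g t) 0)
  rw [Finset.card_univ] at h3
  rw [mul_pow, div_pow, one_pow]
  unfold posq
  rw [one_div, one_div, inv_mul_le_iff₀ (by positivity)]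
  refine h3.trans (le_of_eq ?_)
  field_simp

lemma rad_chan_posq {G : Type*} [Group G] [Fintype G] {c0 : ℕ}
    {ι T : Type*} [Fintype ι] [DecidableEq ι] [Finite T] [Nonempty T]
    {σ φ ρ : ℝ → ℝ}
    (hσL : LipschitzWith 1 σ) (hφL : LipschitzWith 1 φ) (hρL : LipschitzWith 1 ρ)
    (hσ0 : σ 0 = 0) (hφ0 : φ 0 = 0) (hρ0 : ρ 0 = 0)
    (W : T → Fin c0 → G → ℝ) (hW : ∀ t, ∑ k, ∑ h, W t k h ^ 2 ≤ 1)
    (x : ι → Fin c0 → G → ℝ) (b : ℝ) (hx : ∀ i, ∑ k, ∑ h, x i k h ^ 2 ≤ b ^ 2) :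
    ∑ ε : ι → Bool, posq (⨆ t, ∑ i, sgB (ε i) * chanNet σ φ ρ (W t) (x i))
      ≤ 2 ^ Fintype.card ι * (Fintype.card ι * b ^ 2) := by
  have hc : (0 : ℝ) < Fintype.card G := by exact_mod_cast Fintype.card_pos
  refine (contraction_signs majProp_posq (fun _ => φ) (fun _ => lip_abs hφL) (fun _ => hφ0)
    (fun i t => (1 / (Fintype.card G : ℝ)) * ∑ g : G, ρ (σ (gconvChannel (W t) (x i) g)))).trans ?_
  have h1 : ∀ ε : ι → Bool, posq (⨆ t, ∑ i, sgB (ε i) *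
      ((1 / (Fintype.card G : ℝ)) * ∑ g : G, ρ (σ (gconvChannel (W t) (x i) g))))
      ≤ (1 / (Fintype.card G : ℝ)) * ∑ g : G,
        posq (⨆ t, ∑ i, sgB (ε i) * ρ (σ (gconvChannel (W t) (x i) g))) := by
    intro ε
    refine le_trans (le_of_eq ?_) (posq_iSup_avg _)
    congr 1
    refine iSup_congr fun t => ?_
    rw [Finset.sum_comm, Finset.mul_sum]
    refine Finset.sum_congr rfl fun i _ => ?_
    rw [← Finset.mul_sum]
    ring
  refine (Finset.sum_le_sum fun ε _ => h1 ε).trans ?_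
  rw [← Finset.mul_sum, Finset.sum_comm, one_div, inv_mul_le_iff₀ hc]
  have h2 : ∀ g : G, ∑ ε : ι → Bool,
      posq (⨆ t, ∑ i, sgB (ε i) * ρ (σ (gconvChannel (W t) (x i) g)))
      ≤ 2 ^ Fintype.card ι * (Fintype.card ι * b ^ 2) := by
    intro g
    refine (contraction_signs majProp_posq (fun _ => fun z => ρ (σ z))
      (fun _ u v => (lip_abs hρL _ _).trans (lip_abs hσL _ _)) (fun _ => by simp [hσ0, hρ0])
      (fun i t => gconvChannel (W t) (x i) g)).trans ?_
    have h3 : ∀ ε : ι → Bool, posq (⨆ t, ∑ i, sgB (ε i) * gconvChannel (W t) (x i) g)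
        ≤ ∑ k, ∑ h, (∑ i, sgB (ε i) * x i k (g * h)) ^ 2 := by
      intro ε
      obtain ⟨t, ht⟩ := exists_eq_ciSup_of_finite
        (f := fun t => ∑ i, sgB (ε i) * gconvChannel (W t) (x i) g)
      rw [← ht]
      exact (posq_le_sq _).trans (sum_linear_le (W t) (hW t) _ x g)
    refine (Finset.sum_le_sum fun ε _ => h3 ε).trans ?_
    rw [Finset.sum_comm]
    have h4 : ∀ k : Fin c0, ∑ ε : ι → Bool, ∑ h : G, (∑ i, sgB (ε i) * x i k (g * h)) ^ 2
        = 2 ^ Fintype.card ι * ∑ i, ∑ h, x i k h ^ 2 := by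
      intro k
      rw [Finset.sum_comm]
      simp_rw [sum_sgB_sq]
      rw [← Finset.mul_sum, Finset.sum_comm]
      congr 1
      refine Finset.sum_congr rfl fun i _ => ?_
      exact Equiv.sum_comp (Equiv.mulLeft g) (fun h => x i k h ^ 2)
    simp_rw [h4]
    rw [← Finset.mul_sum, Finset.sum_comm]
    refine mul_le_mul_of_nonneg_left ?_ (by positivity)
    refine (Finset.sum_le_sum fun i _ => hx i).trans ?_
    simp
  refine (Finset.sum_le_sum fun g _ => h2 g).trans ?_
  simp

lemma rad_chan_abs {G : Type*} [Group G] [Fintype G] {c0 : ℕ}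
    {ι T : Type*} [Fintype ι] [DecidableEq ι] [Finite T] [Nonempty T]
    {σ φ ρ : ℝ → ℝ}
    (hσL : LipschitzWith 1 σ) (hφL : LipschitzWith 1 φ) (hρL : LipschitzWith 1 ρ)
    (hσ0 : σ 0 = 0) (hφ0 : φ 0 = 0) (hρ0 : ρ 0 = 0)
    (W : T → Fin c0 → G → ℝ) (hW : ∀ t, ∑ k, ∑ h, W t k h ^ 2 ≤ 1)
    (x : ι → Fin c0 → G → ℝ) (b : ℝ) (hx : ∀ i, ∑ k, ∑ h, x i k h ^ 2 ≤ b ^ 2) :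
    ∑ ε : ι → Bool, (⨆ t, |∑ i, sgB (ε i) * chanNet σ φ ρ (W t) (x i)|)
      ≤ 2 ^ Fintype.card ι * Real.sqrt (2 * (Fintype.card ι * b ^ 2)) := by
  apply sum_signs_le_sqrt
  have h0 := rad_chan_posq hσL hφL hρL hσ0 hφ0 hρ0 W hW x b hx
  let X : (ι → Bool) → T → ℝ := fun ε t => ∑ i, sgB (ε i) * chanNet σ φ ρ (W t) (x i)
  have hneg : ∀ ε t, X (fun i => !(ε i)) t = - X ε t := by
    intro ε t
    simp only [X, sgB_not, neg_mul, Finset.sum_neg_distrib]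
  have h1 : ∀ ε, (⨆ t, |X ε t|) ^ 2
      ≤ posq (⨆ t, X ε t) + posq (⨆ t, X (fun i => !(ε i)) t) := by
    intro ε
    obtain ⟨t, ht⟩ := exists_eq_ciSup_of_finite (f := fun t => |X ε t|)
    rw [← ht, sq_abs]
    have a1 := posq_mono (le_iSup_fin (X ε) t)
    have a2 := posq_mono (le_iSup_fin (X (fun i => !(ε i))) t)
    rw [hneg] at a2
    refine le_trans ?_ (add_le_add a1 a2)
    unfold posq
    rcases le_total (X ε t) 0 with h | h
    · rw [max_eq_right h, max_eq_left (by linarith)]; simp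
    · rw [max_eq_left h]; nlinarith [sq_nonneg (max (-X ε t) 0)]
  refine (Finset.sum_le_sum fun ε _ => h1 ε).trans ?_
  rw [Finset.sum_add_distrib, sum_not (fun ε => posq (⨆ t, X ε t))]
  linarith

lemma rad_net {G : Type*} [Group G] [Fintype G] {c0 c1 : ℕ} (hc1 : 0 < c1)
    {ι K : Type*} [Fintype ι] [DecidableEq ι] [Finite K] [Nonempty K]
    {σ φ ρ : ℝ → ℝ}
    (hσL : LipschitzWith 1 σ) (hφL : LipschitzWith 1 φ) (hρL : LipschitzWith 1 ρ)
    (hσh : ∀ a t : ℝ, 0 ≤ a → σ (a * t) = a * σ t)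
    (hφh : ∀ a t : ℝ, 0 ≤ a → φ (a * t) = a * φ t)
    (hρh : ∀ a t : ℝ, 0 ≤ a → ρ (a * t) = a * ρ t)
    {M1 M2 : ℝ} (hM1 : 0 ≤ M1) (hM2 : 0 ≤ M2)
    (u : K → Fin c1 → ℝ) (hu : ∀ t, ∑ j, u t j ^ 2 ≤ M1 ^ 2)
    (w : K → Fin c1 → Fin c0 → G → ℝ) (hw : ∀ t, ∑ j, ∑ k, ∑ h, w t j k h ^ 2 ≤ M2 ^ 2)
    (x : ι → Fin c0 → G → ℝ) (b : ℝ) (hx : ∀ i, ∑ k, ∑ h, x i k h ^ 2 ≤ b ^ 2) :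
    ∑ ε : ι → Bool, (⨆ t, ∑ i, sgB (ε i) * gpoolNet σ φ ρ (u t) (w t) (x i))
      ≤ 2 ^ Fintype.card ι * (M1 * M2 * Real.sqrt (2 * (Fintype.card ι * b ^ 2))) := by
  have : Nonempty (Fin c1) := ⟨⟨0, hc1⟩⟩
  let r : K → Fin c1 → ℝ := fun t j => Real.sqrt (∑ k, ∑ h, w t j k h ^ 2)
  have hr0 : ∀ t j, 0 ≤ r t j := fun t j => Real.sqrt_nonneg _
  have hr2 : ∀ t j, r t j ^ 2 = ∑ k, ∑ h, w t j k h ^ 2 := fun t j =>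
    Real.sq_sqrt (by positivity)
  let W : K × Fin c1 → Fin c0 → G → ℝ := fun p k h => (r p.1 p.2)⁻¹ * w p.1 p.2 k h
  have hwW : ∀ t j, w t j = fun k h => r t j * W (t, j) k h := by
    intro t j
    funext k h
    simp only [W]
    by_cases hz : r t j = 0
    · have h2 := hr2 t j
      rw [hz] at h2
      have h3 : ∑ k, ∑ h, w t j k h ^ 2 = 0 := by rw [← h2]; simp
      rw [Finset.sum_eq_zero_iff_of_nonneg (fun _ _ => by positivity)] at h3
      have h4 := h3 k (Finset.mem_univ _)
      rw [Finset.sum_eq_zero_iff_of_nonneg (fun _ _ => by positivity)] at h4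
      have h5 := h4 h (Finset.mem_univ _)
      rw [hz, zero_mul]
      exact pow_eq_zero_iff (two_ne_zero) |>.1 h5
    · field_simp
  have hW : ∀ p, ∑ k, ∑ h, W p k h ^ 2 ≤ 1 := by
    intro p
    simp only [W, mul_pow, ← Finset.mul_sum]
    rw [← hr2, inv_pow]
    exact inv_mul_le_one
  have hmain := rad_chan_abs hσL hφL hρL (hom_zero hσh) (hom_zero hφh) (hom_zero hρh) W hW x b hx
  have hpt : ∀ ε : ι → Bool, (⨆ t, ∑ i, sgB (ε i) * gpoolNet σ φ ρ (u t) (w t) (x i))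
      ≤ (M1 * M2) * ⨆ p, |∑ i, sgB (ε i) * chanNet σ φ ρ (W p) (x i)| := by
    intro ε
    set S := ⨆ p, |∑ i, sgB (ε i) * chanNet σ φ ρ (W p) (x i)| with hS
    have hSp : ∀ p, |∑ i, sgB (ε i) * chanNet σ φ ρ (W p) (x i)| ≤ S := fun p =>
      le_iSup_fin (fun p => |∑ i, sgB (ε i) * chanNet σ φ ρ (W p) (x i)|) p
    have hS0 : 0 ≤ S := (abs_nonneg _).trans (hSp (Classical.arbitrary _))
    refine ciSup_le fun t => ?_
    have e1 : ∑ i, sgB (ε i) * gpoolNet σ φ ρ (u t) (w t) (x i)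
        = ∑ j, (u t j * r t j) * ∑ i, sgB (ε i) * chanNet σ φ ρ (W (t, j)) (x i) := by
      have : ∀ i, gpoolNet σ φ ρ (u t) (w t) (x i)
          = ∑ j, u t j * (r t j * chanNet σ φ ρ (W (t, j)) (x i)) := by
        intro i
        unfold gpoolNet
        refine Finset.sum_congr rfl fun j _ => ?_
        rw [← chanNet_smul hσh hφh hρh _ (hr0 t j), ← hwW t j]
        rfl
      simp_rw [this, Finset.mul_sum]
      rw [Finset.sum_comm]
      refine Finset.sum_congr rfl fun j _ => Finset.sum_congr rfl fun i _ => by ring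
    rw [e1]
    have e2 : ∑ j, (u t j * r t j) * ∑ i, sgB (ε i) * chanNet σ φ ρ (W (t, j)) (x i)
        ≤ ∑ j, (|u t j| * r t j) * S := by
      refine Finset.sum_le_sum fun j _ => ?_
      refine (le_abs_self _).trans ?_
      rw [abs_mul, abs_mul, abs_of_nonneg (hr0 t j)]
      exact mul_le_mul_of_nonneg_left (hSp (t, j)) (mul_nonneg (abs_nonneg _) (hr0 t j))
    refine e2.trans ?_
    rw [← Finset.sum_mul]
    refine mul_le_mul_of_nonneg_right ?_ hS0
    have e3 := Finset.sum_mul_sq_le_sq_mul_sq (Finset.univ) (fun j => |u t j|) (fun j => r t j)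
    simp only [sq_abs, hr2] at e3
    have e4 : (∑ j, |u t j| * r t j) ^ 2 ≤ (M1 * M2) ^ 2 := by
      refine e3.trans ?_
      rw [mul_pow]
      exact mul_le_mul (hu t) (hw t) (by positivity) (by positivity)
    exact le_of_sq_le_sq e4 (by positivity)
  refine (Finset.sum_le_sum fun ε _ => hpt ε).trans ?_
  rw [← Finset.mul_sum]
  calc _ ≤ (M1 * M2) * (2 ^ Fintype.card ι * Real.sqrt (2 * (Fintype.card ι * b ^ 2))) :=
        mul_le_mul_of_nonneg_left hmain (by positivity)
    _ = _ := by ring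

lemma rad_loss {ι K Y : Type*} [Fintype ι] [DecidableEq ι] [Finite K] [Nonempty K]
    {ℓ : ℝ → Y → ℝ} (hℓlip : ∀ y, LipschitzWith 1 fun t => ℓ t y)
    (a : ι → K → ℝ) (y : ι → Y) :
    ∑ ε : ι → Bool, (⨆ t, ∑ i, sgB (ε i) * ℓ (a i t) (y i))
      ≤ ∑ ε : ι → Bool, (⨆ t, ∑ i, sgB (ε i) * a i t) := by
  have h := contraction_signs majProp_id (fun i z => ℓ z (y i) - ℓ 0 (y i))
    (fun i u v => by simpa using lip_abs (hℓlip (y i)) u v) (fun i => by simp) a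
  refine le_trans (le_of_eq ?_) h
  have h1 : ∀ ε : ι → Bool, (⨆ t, ∑ i, sgB (ε i) * (ℓ (a i t) (y i) - ℓ 0 (y i)))
      = (⨆ t, ∑ i, sgB (ε i) * ℓ (a i t) (y i)) - ∑ i, sgB (ε i) * ℓ 0 (y i) := by
    intro ε
    simp_rw [mul_sub, Finset.sum_sub_distrib]
    rw [ciSup_sub (Set.finite_range _).bddAbove]
  simp_rw [h1]
  have h2 : ∑ ε : ι → Bool, ∑ i, sgB (ε i) * ℓ 0 (y i) = 0 := by
    rw [Finset.sum_comm]
    simp_rw [← Finset.sum_mul, sum_sgB]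
    simp
  rw [Finset.sum_sub_distrib, h2, sub_zero]

/-! ### Symmetrization -/

lemma integrable_bdd {Ω : Type*} [MeasurableSpace Ω] {ν : Measure Ω} [IsProbabilityMeasure ν]
    {F : Ω → ℝ} (hF : Measurable F) (C : ℝ) (hC : ∀ z, |F z| ≤ C) : Integrable F ν :=
  Integrable.of_bound hF.aestronglyMeasurable C (Filter.Eventually.of_forall hC)

lemma abs_iSup_fin {K : Type*} [Finite K] [Nonempty K] (f : K → ℝ) (C : ℝ)
    (h : ∀ k, |f k| ≤ C) : |⨆ k, f k| ≤ C := by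
  obtain ⟨k, hk⟩ := exists_eq_ciSup_of_finite (f := f)
  rw [← hk]
  exact h k

lemma integral_eval {ι Z : Type*} [Fintype ι] [MeasurableSpace Z] (μ : Measure Z)
    [IsProbabilityMeasure μ] {f : Z → ℝ} (hf : Measurable f) (i : ι) :
    ∫ z, f (z i) ∂(Measure.pi fun _ : ι => μ) = ∫ p, f p ∂μ := by
  have h := measurePreserving_eval (fun _ : ι => μ) i
  conv_rhs => rw [← h.map_eq]
  rw [integral_map h.measurable.aemeasurable hf.aestronglyMeasurable]

lemma abs_sum_sg_le {ι Z : Type*} [Fintype ι] {f : Z → ℝ} (hb : ∀ z, |f z| ≤ 1)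
    (ε : ι → Bool) (z : ι → Z) : |∑ i, sgB (ε i) * f (z i)| ≤ Fintype.card ι := by
  refine (Finset.abs_sum_le_sum_abs _ _).trans ?_
  calc _ ≤ ∑ i : ι, (1 : ℝ) := Finset.sum_le_sum fun i _ => by
        rw [abs_mul, abs_sgB, one_mul]; exact hb _
    _ = _ := by simp

/-- The standard balanced sign pattern. -/
def stdSign (m : ℕ) : Fin m ⊕ Fin m → Bool := Sum.elim (fun _ => false) (fun _ => true)

lemma symm_base {Z K : Type*} [MeasurableSpace Z] (μ : Measure Z) [IsProbabilityMeasure μ]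
    [Finite K] [Nonempty K] (m : ℕ) (f : K → Z → ℝ) (hf : ∀ k, Measurable (f k))
    (hb : ∀ k z, |f k z| ≤ 1) :
    ∫ S, (⨆ k, ∑ i, ((∫ p, f k p ∂μ) - f k (S i))) ∂(Measure.pi fun _ : Fin m => μ)
      ≤ ∫ z, (⨆ k, ∑ i, sgB (stdSign m i) * f k (z i))
          ∂(Measure.pi fun _ : Fin m ⊕ Fin m => μ) := by
  have hmp := measurePreserving_sumPiEquivProdPi (fun _ : Fin m ⊕ Fin m => μ)
  let H : (Fin m → Z) × (Fin m → Z) → ℝ := fun q =>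
    ⨆ k, (∑ i, f k (q.2 i) - ∑ i, f k (q.1 i))
  have hcomp : ∀ z : Fin m ⊕ Fin m → Z, (⨆ k, ∑ i, sgB (stdSign m i) * f k (z i))
      = H (MeasurableEquiv.sumPiEquivProdPi (fun _ => Z) z) := by
    intro z
    simp only [H]
    refine iSup_congr fun k => ?_
    rw [Fintype.sum_sum_type]
    simp [stdSign, sgB, MeasurableEquiv.sumPiEquivProdPi, Equiv.sumPiEquivProdPi]
    ring
  have hHm : Measurable H := by
    refine Measurable.iSup fun k => ?_
    have := hf k
    fun_prop
  have hsb : ∀ k (S : Fin m → Z), |∑ i, f k (S i)| ≤ m := by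
    intro k S
    refine (Finset.abs_sum_le_sum_abs _ _).trans ?_
    calc _ ≤ ∑ i : Fin m, (1 : ℝ) := Finset.sum_le_sum fun i _ => hb _ _
      _ = _ := by simp
  have hHb : ∀ q, |H q| ≤ 2 * m := by
    intro q
    refine abs_iSup_fin _ _ fun k => ?_
    have h1 := abs_le.1 (hsb k q.1)
    have h2 := abs_le.1 (hsb k q.2)
    rw [abs_le]; constructor <;> linarith
  simp_rw [hcomp]
  rw [hmp.integral_comp']
  rw [integral_prod _ (integrable_bdd hHm _ hHb)]
  refine integral_mono ?_ ?_ ?_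
  · have hm1 : Measurable fun S : Fin m → Z => ⨆ k, ∑ i, ((∫ p, f k p ∂μ) - f k (S i)) := by
      refine Measurable.iSup fun k => ?_
      have := hf k
      fun_prop
    refine integrable_bdd hm1 (2 * m) fun S => abs_iSup_fin _ _ fun k => ?_
    have hI : |∫ p, f k p ∂μ| ≤ 1 := by
      have := norm_integral_le_of_norm_le_const (μ := μ) (f := f k) (C := 1)
        (Filter.Eventually.of_forall (hb k))
      simpa using this
    rw [Finset.sum_sub_distrib]
    have h1 := abs_le.1 (hsb k S)
    have h2 := abs_le.1 hI
    simp only [Finset.sum_const, Finset.card_univ, Fintype.card_fin, nsmul_eq_mul]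
    have hm0 : (0 : ℝ) ≤ m := by positivity
    rw [abs_le]; constructor <;> nlinarith
  · exact (integrable_bdd hHm _ hHb).integral_prod_left
  · intro S
    refine ciSup_le fun k => ?_
    have hint : Integrable (fun S' : Fin m → Z => ∑ i, f k (S' i) - ∑ i, f k (S i))
        (Measure.pi fun _ : Fin m => μ) := by
      refine integrable_bdd ?_ (2 * m) fun S' => ?_
      · have := hf k
        fun_prop
      · have h1 := abs_le.1 (hsb k S)
        have h2 := abs_le.1 (hsb k S')
        rw [abs_le]; constructor <;> linarith
    have hint2 : Integrable (fun S' : Fin m → Z => ∑ i, f k (S' i))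
        (Measure.pi fun _ : Fin m => μ) := by
      refine integrable_bdd ?_ m fun S' => hsb k S'
      have := hf k
      fun_prop
    have heq : ∑ i, ((∫ p, f k p ∂μ) - f k (S i))
        = ∫ S', (∑ i, f k (S' i) - ∑ i, f k (S i)) ∂(Measure.pi fun _ : Fin m => μ) := by
      rw [integral_sub hint2 (integrable_const _), integral_finsetSum]
      · simp_rw [integral_eval μ (hf k)]
        rw [Finset.sum_sub_distrib]
        simp
      · intro i _
        refine integrable_bdd ?_ 1 fun S' => hb k _
        have := hf k
        fun_prop
    rw [heq]
    refine integral_mono hint ?_ fun S' => ?_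
    · refine integrable_bdd (hHm.comp measurable_prodMk_left) (2 * m) fun S' => hHb _
    · exact le_iSup_fin (fun k => ∑ i, f k (S' i) - ∑ i, f k (S i)) k

lemma integral_perm {ι Z : Type*} [Fintype ι] [MeasurableSpace Z] (μ : Measure Z)
    [IsProbabilityMeasure μ] (e : ι ≃ ι) (F : (ι → Z) → ℝ) :
    ∫ z, F (fun j => z (e.symm j)) ∂(Measure.pi fun _ : ι => μ)
      = ∫ z, F z ∂(Measure.pi fun _ : ι => μ) := by
  have h := measurePreserving_piCongrLeft (fun _ : ι => μ) e
  rw [← h.integral_comp' F]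
  refine integral_congr_ae (Filter.Eventually.of_forall fun z => ?_)
  simp only
  congr 1
  funext j
  obtain ⟨i, rfl⟩ := e.surjective j
  have := Equiv.piCongrLeft_apply_apply (fun _ : ι => Z) e z i
  rw [MeasurableEquiv.coe_piCongrLeft, this]
  simp

lemma exists_balanced (m : ℕ) (ε : Fin m ⊕ Fin m → Bool) :
    ∃ e : (Fin m ⊕ Fin m) ≃ (Fin m ⊕ Fin m),
      ∑ i, |sgB (ε i) - sgB (stdSign m (e i))| ≤ |∑ i, sgB (ε i)| := by
  classical
  -- a balanced set of minus signs comparable with that of `ε`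
  let Mi : Finset (Fin m ⊕ Fin m) := Finset.univ.filter fun i => ε i = false
  have hI : ∃ I : Finset (Fin m ⊕ Fin m), I.card = m ∧ (I ⊆ Mi ∨ Mi ⊆ I) := by
    rcases le_total m Mi.card with h | h
    · obtain ⟨I, h1, h2⟩ := Finset.exists_subset_card_eq h
      exact ⟨I, h2, Or.inl h1⟩
    · obtain ⟨I, h1, _, h2⟩ := Finset.exists_subsuperset_card_eq (Finset.subset_univ Mi) h
        (by simp)
      exact ⟨I, h2, Or.inr h1⟩
  obtain ⟨I, hIc, hIM⟩ := hI
  let ε' : Fin m ⊕ Fin m → Bool := fun i => decide (i ∉ I)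
  have hcard : ∀ c, Fintype.card {a // ε' a = c} = Fintype.card {b // stdSign m b = c} := by
    have h1 : Fintype.card {a // ε' a = false} = m := by
      rw [Fintype.card_subtype]
      simp [ε', hIc]
    have h2 : Fintype.card {a // ε' a = true} = m := by
      rw [Fintype.card_subtype]
      have : (Finset.univ.filter fun a => ε' a = true) = Iᶜ := by ext a; simp [ε']
      rw [this, Finset.card_compl, hIc]; simp
    have h3 : Fintype.card {a // stdSign m a = false} = m := by
      rw [Fintype.card_subtype, Finset.card_filter, Fintype.sum_sum_type]
      simp [stdSign]
    have h4 : Fintype.card {a // stdSign m a = true} = m := by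
      rw [Fintype.card_subtype, Finset.card_filter, Fintype.sum_sum_type]
      simp [stdSign]
    intro c
    cases c
    · rw [h1, h3]
    · rw [h2, h4]
  let e := Equiv.ofFiberEquiv fun c => Fintype.equivOfCardEq (hcard c)
  refine ⟨e, ?_⟩
  have he : ∀ i, stdSign m (e i) = ε' i := fun i =>
    Equiv.ofFiberEquiv_map (fun c => Fintype.equivOfCardEq (hcard c)) i
  simp_rw [he]
  have hbal : ∑ i, sgB (ε' i) = 0 := by
    have : ∑ i, sgB (ε' i) = ∑ i, sgB (stdSign m i) := by
      rw [← Equiv.sum_comp e (fun i => sgB (stdSign m i))]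
      exact Finset.sum_congr rfl fun i _ => by rw [he]
    rw [this, Fintype.sum_sum_type]
    simp [stdSign, sgB]
  have hsum : ∑ i, sgB (ε i) = ∑ i, (sgB (ε i) - sgB (ε' i)) := by
    rw [Finset.sum_sub_distrib, hbal, sub_zero]
  rw [hsum]
  have hmem : ∀ i, i ∈ Mi ↔ ε i = false := fun i => by simp [Mi]
  rcases hIM with h | h
  · have hs : ∀ i, sgB (ε i) - sgB (ε' i) ≤ 0 := by
      intro i
      have h1 : i ∈ I → ε i = false := fun hi => (hmem i).1 (h hi)
      by_cases hi : i ∈ I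
      · simp [ε', hi, h1 hi]
      · cases hε : ε i <;> simp [ε', hi, sgB]
    rw [abs_of_nonpos (Finset.sum_nonpos fun i _ => hs i), ← Finset.sum_neg_distrib]
    exact le_of_eq (Finset.sum_congr rfl fun i _ => abs_of_nonpos (hs i))
  · have hs : ∀ i, 0 ≤ sgB (ε i) - sgB (ε' i) := by
      intro i
      have h1 : i ∉ I → ε i = true := fun hi => by
        by_contra hc
        exact hi (h ((hmem i).2 (by simpa using hc)))
      by_cases hi : i ∈ I
      · cases hε : ε i <;> simp [ε', hi, sgB]
      · simp [ε', hi, h1 hi]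
    rw [abs_of_nonneg (Finset.sum_nonneg fun i _ => hs i)]
    exact le_of_eq (Finset.sum_congr rfl fun i _ => abs_of_nonneg (hs i))

lemma symm_signs {Z K : Type*} [MeasurableSpace Z] (μ : Measure Z) [IsProbabilityMeasure μ]
    [Finite K] [Nonempty K] (m : ℕ) (f : K → Z → ℝ) (hf : ∀ k, Measurable (f k))
    (hb : ∀ k z, |f k z| ≤ 1) (ε : Fin m ⊕ Fin m → Bool) :
    ∫ S, (⨆ k, ∑ i, ((∫ p, f k p ∂μ) - f k (S i))) ∂(Measure.pi fun _ : Fin m => μ)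
      ≤ (∫ z, (⨆ k, ∑ i, sgB (ε i) * f k (z i))
          ∂(Measure.pi fun _ : Fin m ⊕ Fin m => μ)) + |∑ i, sgB (ε i)| := by
  obtain ⟨e, he⟩ := exists_balanced m ε
  refine (symm_base μ m f hf hb).trans ?_
  rw [← integral_perm μ e]
  have hmeas : ∀ ε' : Fin m ⊕ Fin m → Bool, Measurable fun z : Fin m ⊕ Fin m → Z =>
      ⨆ k, ∑ i, sgB (ε' i) * f k (z i) := by
    intro ε'
    refine Measurable.iSup fun k => ?_
    have := hf k
    fun_prop
  have hint : ∀ ε' : Fin m ⊕ Fin m → Bool, Integrable (fun z : Fin m ⊕ Fin m → Z =>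
      ⨆ k, ∑ i, sgB (ε' i) * f k (z i)) (Measure.pi fun _ : Fin m ⊕ Fin m => μ) := fun ε' =>
    integrable_bdd (hmeas ε') _ fun z => abs_iSup_fin _ _ fun k => abs_sum_sg_le (hb k) ε' z
  have hre : ∀ z : Fin m ⊕ Fin m → Z,
      (⨆ k, ∑ i, sgB (stdSign m i) * f k (z (e.symm i)))
        = ⨆ k, ∑ i, sgB (stdSign m (e i)) * f k (z i) := by
    intro z
    refine iSup_congr fun k => ?_
    rw [← Equiv.sum_comp e]
    simp
  simp_rw [hre]
  calc _ ≤ ∫ z, ((⨆ k, ∑ i, sgB (ε i) * f k (z i)) + |∑ i, sgB (ε i)|)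
          ∂(Measure.pi fun _ : Fin m ⊕ Fin m => μ) := by
        refine integral_mono (hint fun i => stdSign m (e i)) ((hint ε).add (integrable_const _)) ?_
        intro z
        refine ciSup_le fun k => ?_
        have h1 := le_iSup_fin (fun k => ∑ i, sgB (ε i) * f k (z i)) k
        have h2 : ∑ i, sgB (stdSign m (e i)) * f k (z i) - ∑ i, sgB (ε i) * f k (z i)
            ≤ ∑ i, |sgB (ε i) - sgB (stdSign m (e i))| := by
          rw [← Finset.sum_sub_distrib]
          refine Finset.sum_le_sum fun i _ => ?_
          rw [← sub_mul]
          refine (le_abs_self _).trans ?_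
          rw [abs_mul, abs_sub_comm]
          exact mul_le_of_le_one_right (abs_nonneg _) (hb k _)
        simp only at h1 ⊢
        linarith
    _ = _ := by
        rw [integral_add (hint ε) (integrable_const _)]
        simp

lemma symm_final {Z K : Type*} [MeasurableSpace Z] (μ : Measure Z) [IsProbabilityMeasure μ]
    [Finite K] [Nonempty K] (m : ℕ) (f : K → Z → ℝ) (hf : ∀ k, Measurable (f k))
    (hb : ∀ k z, |f k z| ≤ 1) (R : ℝ)
    (hR : ∀ᵐ z ∂(Measure.pi fun _ : Fin m ⊕ Fin m => μ),
      ∑ ε : Fin m ⊕ Fin m → Bool, (⨆ k, ∑ i, sgB (ε i) * f k (z i))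
        ≤ 2 ^ Fintype.card (Fin m ⊕ Fin m) * R) :
    ∫ S, (⨆ k, ∑ i, ((∫ p, f k p ∂μ) - f k (S i))) ∂(Measure.pi fun _ : Fin m => μ)
      ≤ R + Real.sqrt (2 * m) := by
  set D := ∫ S, (⨆ k, ∑ i, ((∫ p, f k p ∂μ) - f k (S i))) ∂(Measure.pi fun _ : Fin m => μ)
  have hint : ∀ ε' : Fin m ⊕ Fin m → Bool, Integrable (fun z : Fin m ⊕ Fin m → Z =>
      ⨆ k, ∑ i, sgB (ε' i) * f k (z i)) (Measure.pi fun _ : Fin m ⊕ Fin m => μ) := fun ε' => by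
    refine integrable_bdd (Measurable.iSup fun k => ?_) _ fun z =>
      abs_iSup_fin _ _ fun k => abs_sum_sg_le (hb k) ε' z
    have := hf k
    fun_prop
  have h1 := Finset.sum_le_sum (s := Finset.univ) fun ε _ => symm_signs μ m f hf hb ε
  rw [Finset.sum_add_distrib, ← integral_finsetSum _ fun ε _ => hint ε] at h1
  have h2 : ∫ z, ∑ ε : Fin m ⊕ Fin m → Bool, (⨆ k, ∑ i, sgB (ε i) * f k (z i))
      ∂(Measure.pi fun _ : Fin m ⊕ Fin m => μ) ≤ 2 ^ Fintype.card (Fin m ⊕ Fin m) * R := by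
    refine (integral_mono_ae (integrable_finsetSum _ fun ε _ => hint ε)
      (integrable_const _) hR).trans ?_
    simp
  have h3 : ∑ ε : Fin m ⊕ Fin m → Bool, |∑ i, sgB (ε i)|
      ≤ 2 ^ Fintype.card (Fin m ⊕ Fin m) * Real.sqrt (2 * m) := by
    apply sum_signs_le_sqrt
    have := sum_sgB_sq (ι := Fin m ⊕ Fin m) (fun _ => 1)
    simp only [mul_one, one_pow] at this
    simp only [sq_abs]
    rw [this]
    simp
    exact le_of_eq (by ring)
  have h4 : ∑ _ε : Fin m ⊕ Fin m → Bool, D = 2 ^ Fintype.card (Fin m ⊕ Fin m) * D := by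
    simp
  rw [h4] at h1
  have hp : (0 : ℝ) < 2 ^ Fintype.card (Fin m ⊕ Fin m) := by positivity
  refine le_of_mul_le_mul_left ?_ hp
  linarith

/-! ### Bounded differences inequality -/

lemma hasSubgaussian_osc {Z : Type*} [MeasurableSpace Z] (μ : Measure Z) [IsProbabilityMeasure μ]
    {X : Z → ℝ} (hX : Measurable X) (c : NNReal) (hosc : ∀ a b, |X a - X b| ≤ c) :
    ProbabilityTheory.HasSubgaussianMGF (fun z => X z - ∫ p, X p ∂μ) (c ^ 2) μ := by
  have hne : Nonempty Z := by
    by_contra h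
    rw [not_nonempty_iff] at h
    have h1 : μ Set.univ = 1 := measure_univ
    rw [Set.eq_empty_of_isEmpty Set.univ] at h1
    simp at h1
  obtain ⟨z0⟩ := hne
  have h := ProbabilityTheory.hasSubgaussianMGF_of_mem_Icc (μ := μ) (X := X)
    (a := X z0 - c) (b := X z0 + c) hX.aemeasurable (Filter.Eventually.of_forall fun z => by
      have := abs_le.1 (hosc z z0)
      constructor <;> linarith)
  have e : (‖X z0 + c - (X z0 - c)‖₊ / 2) ^ 2 = c ^ 2 := by
    congr 1
    have : X z0 + c - (X z0 - c) = 2 * (c : ℝ) := by ring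
    rw [this]
    ext
    simp
  rw [e] at h
  exact h

lemma mcdiarmid_mgf {Z : Type*} [MeasurableSpace Z] (μ : Measure Z) [IsProbabilityMeasure μ]
    (c : NNReal) (C : ℝ) (t : ℝ) : ∀ (n : ℕ) (F : (Fin n → Z) → ℝ), Measurable F →
    (∀ z, |F z| ≤ C) →
    (∀ z i a, |F (Function.update z i a) - F z| ≤ c) →
    ∫ z, Real.exp (t * (F z - ∫ z, F z ∂(Measure.pi fun _ : Fin n => μ)))
      ∂(Measure.pi fun _ : Fin n => μ) ≤ Real.exp (n * c ^ 2 * t ^ 2 / 2) := by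
  intro n
  induction n with
  | zero =>
    intro F hF hC hd
    have hconst : ∀ z : Fin 0 → Z, F z = F default := fun z => by
      rw [Subsingleton.elim z default]
    simp_rw [hconst]
    simp
  | succ n ih =>
    intro F hF hC hd
    have hmp := (measurePreserving_piFinSuccAbove (fun _ : Fin (n + 1) => μ) 0).symm
    set ν := Measure.pi fun _ : Fin n => μ with hν
    let E := (MeasurableEquiv.piFinSuccAbove (fun _ : Fin (n + 1) => Z) 0).symm
    have hE : ∀ a z, E (a, z) = Fin.cons a z := by
      intro a z
      simp [E, MeasurableEquiv.piFinSuccAbove, Fin.insertNthEquiv, Fin.insertNth_zero]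
    let H : Z × (Fin n → Z) → ℝ := fun q => F (E q)
    have hHm : Measurable H := hF.comp E.measurable
    have hHb : ∀ q, |H q| ≤ C := fun q => hC _
    have hH1 : ∀ a z i b, |H (a, Function.update z i b) - H (a, z)| ≤ c := by
      intro a z i b
      simp only [H, hE, Fin.cons_update]
      exact hd _ _ _
    have hH0 : ∀ a b z, |H (a, z) - H (b, z)| ≤ c := by
      intro a b z
      simp only [H, hE]
      have := hd (Fin.cons b z : Fin (n + 1) → Z) 0 a
      rwa [Fin.update_cons_zero] at this
    have hint : ∀ a, Integrable (fun z => H (a, z)) ν := fun a =>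
      integrable_bdd (hHm.comp measurable_prodMk_left) C fun z => hHb _
    have hHint : Integrable H (μ.prod ν) := integrable_bdd hHm C hHb
    let g : Z → ℝ := fun a => ∫ z, H (a, z) ∂ν
    have hg : Measurable g := (hHm.stronglyMeasurable.integral_prod_right').measurable
    have hgb : ∀ a, |g a| ≤ C := by
      intro a
      have := norm_integral_le_of_norm_le_const (μ := ν) (f := fun z => H (a, z)) (C := C)
        (Filter.Eventually.of_forall fun z => hHb _)
      simpa using this
    have hgo : ∀ a b, |g a - g b| ≤ c := by
      intro a b
      simp only [g]
      rw [← integral_sub (hint a) (hint b)]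
      have := norm_integral_le_of_norm_le_const (μ := ν) (f := fun z => H (a, z) - H (b, z))
        (C := c) (Filter.Eventually.of_forall fun z => hH0 a b z)
      simpa using this
    have hEF : ∫ z, F z ∂(Measure.pi fun _ : Fin (n + 1) => μ) = ∫ a, g a ∂μ := by
      rw [← hmp.integral_comp']
      exact integral_prod _ hHint
    rw [hEF]
    set A := ∫ a, g a ∂μ
    rw [← hmp.integral_comp']
    have hexpm : Measurable fun q : Z × (Fin n → Z) => Real.exp (t * (H q - A)) := by fun_prop
    have hexpb : ∀ q : Z × (Fin n → Z),
        |Real.exp (t * (H q - A))| ≤ Real.exp (|t| * (C + |A|)) := by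
      intro q
      rw [abs_of_pos (Real.exp_pos _), Real.exp_le_exp]
      refine (le_abs_self _).trans ?_
      rw [abs_mul]
      refine mul_le_mul_of_nonneg_left ?_ (abs_nonneg _)
      exact (abs_sub _ _).trans (add_le_add (hHb q) le_rfl)
    have hexpi : Integrable (fun q : Z × (Fin n → Z) => Real.exp (t * (H q - A))) (μ.prod ν) :=
      integrable_bdd hexpm _ hexpb
    have hstep : ∫ q, Real.exp (t * (H q - A)) ∂(μ.prod ν)
        ≤ ∫ a, Real.exp (t * (g a - A)) * Real.exp (n * c ^ 2 * t ^ 2 / 2) ∂μ := by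
      rw [integral_prod _ hexpi]
      refine integral_mono hexpi.integral_prod_left ?_ ?_
      · refine Integrable.mul_const ?_ _
        refine integrable_bdd (by fun_prop) (Real.exp (|t| * (C + |A|))) fun a => ?_
        rw [abs_of_pos (Real.exp_pos _), Real.exp_le_exp]
        refine (le_abs_self _).trans ?_
        rw [abs_mul]
        refine mul_le_mul_of_nonneg_left ?_ (abs_nonneg _)
        exact (abs_sub _ _).trans (add_le_add (hgb a) le_rfl)
      · intro a
        have hi := ih (fun z => H (a, z)) (hHm.comp measurable_prodMk_left) (fun z => hHb _)
          (hH1 a)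
        have he : ∀ z, Real.exp (t * (H (a, z) - A))
            = Real.exp (t * (g a - A)) * Real.exp (t * (H (a, z) - g a)) := by
          intro z
          rw [← Real.exp_add]
          congr 1
          ring
        simp only [he]
        rw [integral_const_mul]
        exact mul_le_mul_of_nonneg_left hi (Real.exp_pos _).le
    refine hstep.trans ?_
    rw [integral_mul_const]
    have hs := (hasSubgaussian_osc μ hg c hgo).mgf_le t
    unfold ProbabilityTheory.mgf at hs
    calc _ ≤ Real.exp (((c ^ 2 : NNReal) : ℝ) * t ^ 2 / 2) * Real.exp (n * c ^ 2 * t ^ 2 / 2) :=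
          mul_le_mul_of_nonneg_right hs (Real.exp_pos _).le
      _ = _ := by
          rw [← Real.exp_add]
          congr 1
          push_cast
          ring

lemma mcdiarmid_tail {Z : Type*} [MeasurableSpace Z] (μ : Measure Z) [IsProbabilityMeasure μ]
    (c : NNReal) (C : ℝ) (n : ℕ) (F : (Fin n → Z) → ℝ) (hF : Measurable F)
    (hC : ∀ z, |F z| ≤ C)
    (hd : ∀ z i a, |F (Function.update z i a) - F z| ≤ c) (s : ℝ) (hs : 0 ≤ s) :
    (Measure.pi fun _ : Fin n => μ).real
      {z | s ≤ F z - ∫ z, F z ∂(Measure.pi fun _ : Fin n => μ)}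
      ≤ Real.exp (- s ^ 2 / (2 * (n * c ^ 2))) := by
  have h : ProbabilityTheory.HasSubgaussianMGF
      (fun z => F z - ∫ z, F z ∂(Measure.pi fun _ : Fin n => μ)) (n * c ^ 2)
      (Measure.pi fun _ : Fin n => μ) := by
    refine ⟨fun t => ?_, fun t => ?_⟩
    · set A := ∫ z, F z ∂(Measure.pi fun _ : Fin n => μ)
      refine integrable_bdd (by fun_prop) (Real.exp (|t| * (C + |A|))) fun a => ?_
      rw [abs_of_pos (Real.exp_pos _), Real.exp_le_exp]
      refine (le_abs_self _).trans ?_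
      rw [abs_mul]
      refine mul_le_mul_of_nonneg_left ?_ (abs_nonneg _)
      exact (abs_sub _ _).trans (add_le_add (hC a) le_rfl)
    · have := mcdiarmid_mgf μ c C t n F hF hC hd
      unfold ProbabilityTheory.mgf
      push_cast
      exact this
  have := h.measure_ge_le hs
  push_cast at this
  exact this

/-! ### Final assembly -/

lemma continuous_gpoolNet {G : Type*} [Group G] [Fintype G] {c0 c1 : ℕ}
    {σ φ ρ : ℝ → ℝ} (hσ : Continuous σ) (hφ : Continuous φ) (hρ : Continuous ρ) :
    Continuous fun q : ((Fin c1 → ℝ) × (Fin c1 → Fin c0 → G → ℝ)) × (Fin c0 → G → ℝ) =>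
      gpoolNet σ φ ρ q.1.1 q.1.2 q.2 := by
  unfold gpoolNet gconvChannel
  fun_prop

/-- Uniform deviation for a finite family of bounded functions. -/
lemma finite_family_tail {Z K : Type*} [MeasurableSpace Z] (μ : Measure Z)
    [IsProbabilityMeasure μ] [Finite K] [Nonempty K] (m : ℕ) (hm : 0 < m) (f : K → Z → ℝ)
    (hf : ∀ k, Measurable (f k)) (hb : ∀ k z, |f k z| ≤ 1) (R δ : ℝ) (hδ0 : 0 < δ) (hδ1 : δ < 1)
    (hR : ∫ S, (⨆ k, ∑ i, ((∫ p, f k p ∂μ) - f k (S i))) ∂(Measure.pi fun _ : Fin m => μ) ≤ R) :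
    (Measure.pi fun _ : Fin m => μ).real
      {S | ∃ k, R + Real.sqrt (8 * m * Real.log (1 / δ)) < ∑ i, ((∫ p, f k p ∂μ) - f k (S i))}
      ≤ δ := by
  let F : (Fin m → Z) → ℝ := fun S => ⨆ k, ∑ i, ((∫ p, f k p ∂μ) - f k (S i))
  have hI : ∀ k, |∫ p, f k p ∂μ| ≤ 1 := by
    intro k
    have := norm_integral_le_of_norm_le_const (μ := μ) (f := f k) (C := 1)
      (Filter.Eventually.of_forall (hb k))
    simpa using this
  have hF : Measurable F := by
    refine Measurable.iSup fun k => ?_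
    have := hf k
    fun_prop
  have hC : ∀ S, |F S| ≤ 2 * m := by
    intro S
    refine abs_iSup_fin _ _ fun k => ?_
    refine (Finset.abs_sum_le_sum_abs _ _).trans ?_
    calc _ ≤ ∑ i : Fin m, (2 : ℝ) := Finset.sum_le_sum fun i _ => by
          have := (abs_sub (∫ p, f k p ∂μ) (f k (S i))).trans (add_le_add (hI k) (hb k (S i)))
          linarith
      _ = _ := by simp; ring
  have hterm : ∀ (S : Fin m → Z) i a k,
      |∑ j, ((∫ p, f k p ∂μ) - f k (Function.update S i a j))
        - ∑ j, ((∫ p, f k p ∂μ) - f k (S j))| ≤ 2 := by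
    intro S i a k
    rw [← Finset.sum_sub_distrib, Finset.sum_eq_single i]
    · simp only [Function.update_self]
      have h1 := abs_le.1 (hb k a)
      have h2 := abs_le.1 (hb k (S i))
      rw [abs_le]; constructor <;> linarith
    · intro j _ hj
      simp [Function.update_of_ne hj]
    · simp
  have hd : ∀ S i a, |F (Function.update S i a) - F S| ≤ ((2 : NNReal) : ℝ) := by
    intro S i a
    have h1 : F (Function.update S i a) ≤ F S + 2 := by
      refine ciSup_le fun k => ?_
      have e1 := le_iSup_fin (fun k => ∑ j, ((∫ p, f k p ∂μ) - f k (S j))) k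
      have e2 := (abs_le.1 (hterm S i a k)).2
      simp only [F]
      linarith
    have h2 : F S ≤ F (Function.update S i a) + 2 := by
      refine ciSup_le fun k => ?_
      have e1 := le_iSup_fin (fun k => ∑ j, ((∫ p, f k p ∂μ) - f k (Function.update S i a j))) k
      have e2 := (abs_le.1 (hterm S i a k)).1
      simp only [F]
      linarith
    rw [abs_le]; push_cast; constructor <;> linarith
  have hL : 0 ≤ Real.log (1 / δ) := Real.log_nonneg (by rw [le_div_iff₀ hδ0]; linarith)
  have hm0 : (0 : ℝ) < m := by exact_mod_cast hm
  have htail := mcdiarmid_tail μ 2 (2 * m) m F hF hC hd (Real.sqrt (8 * m * Real.log (1 / δ)))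
    (Real.sqrt_nonneg _)
  have hexp : Real.exp (-(Real.sqrt (8 * m * Real.log (1 / δ))) ^ 2
      / (2 * (m * ((2 : NNReal) : ℝ) ^ 2))) = δ := by
    rw [Real.sq_sqrt (by positivity)]
    have : -(8 * m * Real.log (1 / δ)) / (2 * (m * ((2 : NNReal) : ℝ) ^ 2)) = Real.log δ := by
      rw [one_div, Real.log_inv]
      push_cast
      field_simp
      ring
    rw [this, Real.exp_log hδ0]
  rw [hexp] at htail
  refine le_trans (measureReal_mono ?_ (measure_ne_top _ _)) htail
  rintro S ⟨k, hk⟩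
  have e1 := le_iSup_fin (fun k => ∑ j, ((∫ p, f k p ∂μ) - f k (S j))) k
  simp only [Set.mem_setOf_eq, F]
  linarith

lemma final_arith (m : ℕ) (hm : 0 < m) (B δ : ℝ) (hδ0 : 0 < δ) (hδ1 : δ < 1) :
    (2 * B * Real.sqrt m + Real.sqrt (2 * m)) + Real.sqrt (8 * m * Real.log (1 / δ))
      ≤ m * (2 * (B / Real.sqrt m) + 4 * Real.sqrt (2 * Real.log (4 / δ) / m)) := by
  have hm0 : (0 : ℝ) < m := by exact_mod_cast hm
  set s := Real.sqrt m with hs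
  have hs0 : 0 < s := Real.sqrt_pos.2 hm0
  have hss : (m : ℝ) = s * s := (Real.mul_self_sqrt hm0.le).symm
  have hL : 0 ≤ Real.log (1 / δ) := Real.log_nonneg (by rw [le_div_iff₀ hδ0]; linarith)
  have hlog4 : 1 ≤ Real.log 4 := by
    rw [Real.le_log_iff_exp_le (by norm_num)]
    have := Real.exp_one_lt_d9
    linarith
  have hLL : Real.log (4 / δ) = Real.log 4 + Real.log (1 / δ) := by
    rw [← Real.log_mul (by norm_num) (by positivity)]
    congr 1
    ring
  set L := Real.log (1 / δ)
  set q := Real.sqrt (2 * Real.log (4 / δ)) with hq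
  have e1 : Real.sqrt (2 * Real.log (4 / δ) / m) = q / s := by
    rw [Real.sqrt_div (by rw [hLL]; linarith)]
  have e2 : Real.sqrt (2 * m) ≤ q * s := by
    rw [Real.sqrt_mul (by norm_num)]
    exact mul_le_mul_of_nonneg_right (Real.sqrt_le_sqrt (by rw [hLL]; linarith)) hs0.le
  have e3 : Real.sqrt (8 * m * L) ≤ 2 * (q * s) := by
    have : 8 * m * L = 2 ^ 2 * ((2 * L) * m) := by ring
    rw [this, Real.sqrt_mul (by norm_num), Real.sqrt_sq (by norm_num), Real.sqrt_mul (by positivity)]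
    refine mul_le_mul_of_nonneg_left ?_ (by norm_num)
    exact mul_le_mul_of_nonneg_right (Real.sqrt_le_sqrt (by rw [hLL]; linarith)) hs0.le
  have hq0 : 0 ≤ q * s := mul_nonneg (Real.sqrt_nonneg _) hs0.le
  rw [e1]
  have e4 : (m : ℝ) * (2 * (B / s) + 4 * (q / s)) = 2 * B * s + 4 * (q * s) := by
    rw [hss]; field_simp
  rw [e4]
  linarith


theorem generalization_bound_general_pooling
    {G : Type*} [Group G] [Fintype G]
    (c0 c1 m : ℕ) (hc0 : 0 < c0) (hc1 : 0 < c1) (hm : 0 < m)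
    (bx M1 M2 : ℝ) (hbx : 0 ≤ bx) (hM1 : 0 ≤ M1) (hM2 : 0 ≤ M2)
    (δ : ℝ) (hδ0 : 0 < δ) (hδ1 : δ < 1)
    (σ φ ρ : ℝ → ℝ)
    (hσL : LipschitzWith 1 σ) (hφL : LipschitzWith 1 φ) (hρL : LipschitzWith 1 ρ)
    (hσh : ∀ a t : ℝ, 0 ≤ a → σ (a * t) = a * σ t)
    (hφh : ∀ a t : ℝ, 0 ≤ a → φ (a * t) = a * φ t)
    (hρh : ∀ a t : ℝ, 0 ≤ a → ρ (a * t) = a * ρ t)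
    {Y : Type*} [MeasurableSpace Y]
    (ℓ : ℝ → Y → ℝ)
    (hℓmeas : Measurable (Function.uncurry ℓ))
    (hℓbdd : ∀ t y, |ℓ t y| ≤ 1)
    (hℓlip : ∀ y, LipschitzWith 1 fun t => ℓ t y)
    (μ : Measure ((Fin c0 → G → ℝ) × Y)) [IsProbabilityMeasure μ]
    (hsupp : μ {p | Real.sqrt (∑ k : Fin c0, ∑ g : G, (p.1 k g) ^ 2) ≤ bx} = 1) :
    (Measure.pi fun _ : Fin m => μ)
      {S : Fin m → (Fin c0 → G → ℝ) × Y |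
        ∀ (u : Fin c1 → ℝ) (w : Fin c1 → Fin c0 → G → ℝ),
          Real.sqrt (∑ j : Fin c1, (u j) ^ 2) ≤ M1 →
          Real.sqrt (∑ j : Fin c1, ∑ k : Fin c0, ∑ g : G, (w j k g) ^ 2) ≤ M2 →
          (∫ p, ℓ (gpoolNet σ φ ρ u w p.1) p.2 ∂μ) ≤
            (1 / (m : ℝ)) * ∑ i : Fin m, ℓ (gpoolNet σ φ ρ u w (S i).1) (S i).2
              + 2 * (bx * M1 * M2 / Real.sqrt m)
              + 4 * Real.sqrt (2 * Real.log (4 / δ) / m)}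
      ≥ ENNReal.ofReal (1 - δ) := by
  have hm0 : (0 : ℝ) < m := by exact_mod_cast hm
  have hcont := continuous_gpoolNet (G := G) (c0 := c0) (c1 := c1)
    hσL.continuous hφL.continuous hρL.continuous
  -- the class of parameters
  let P : Set ((Fin c1 → ℝ) × (Fin c1 → Fin c0 → G → ℝ)) :=
    {p | Real.sqrt (∑ j, (p.1 j) ^ 2) ≤ M1 ∧ Real.sqrt (∑ j, ∑ k, ∑ g, (p.2 j k g) ^ 2) ≤ M2}
  have : Nonempty P := ⟨⟨(0, 0), by simp [hM1], by simp [hM2]⟩⟩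
  let f : P → (Fin c0 → G → ℝ) × Y → ℝ := fun p z => ℓ (gpoolNet σ φ ρ p.1.1 p.1.2 z.1) z.2
  have hfm : ∀ p, Measurable (f p) := by
    intro p
    have h1 : Continuous fun x : Fin c0 → G → ℝ => gpoolNet σ φ ρ p.1.1 p.1.2 x :=
      hcont.comp (by fun_prop : Continuous fun x : Fin c0 → G → ℝ => (p.1, x))
    exact hℓmeas.comp ((h1.measurable.comp measurable_fst).prodMk measurable_snd)
  have hfb : ∀ p z, |f p z| ≤ 1 := fun p z => hℓbdd _ _
  have hfc : ∀ z, Continuous fun p : P => f p z := by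
    intro z
    have h1 : Continuous fun p : P => gpoolNet σ φ ρ p.1.1 p.1.2 z.1 :=
      hcont.comp (by fun_prop : Continuous fun p : P => (p.1, z.1))
    exact (hℓlip z.2).continuous.comp h1
  have hIc : Continuous fun p : P => ∫ z, f p z ∂μ :=
    continuous_of_dominated (bound := fun _ => 1) (fun p => (hfm p).aestronglyMeasurable)
      (fun p => Filter.Eventually.of_forall (hfb p)) (integrable_const _)
      (Filter.Eventually.of_forall hfc)
  let q : ℕ → P := TopologicalSpace.denseSeq P
  set bd : ℝ := 2 * (bx * M1 * M2 / Real.sqrt m) + 4 * Real.sqrt (2 * Real.log (4 / δ) / m) with hbd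
  let Bad : ℕ → Set (Fin m → (Fin c0 → G → ℝ) × Y) := fun N =>
    {S | ∃ k : Fin (N + 1), m * bd < ∑ i, ((∫ z, f (q k) z ∂μ) - f (q k) (S i))}
  have hae : ∀ᵐ z ∂(Measure.pi fun _ : Fin m ⊕ Fin m => μ),
      ∀ i, ∑ k, ∑ g, ((z i).1 k g) ^ 2 ≤ bx ^ 2 := by
    rw [ae_all_iff]
    intro i
    have hset : MeasurableSet {p : (Fin c0 → G → ℝ) × Y |
        Real.sqrt (∑ k : Fin c0, ∑ g : G, (p.1 k g) ^ 2) ≤ bx} := by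
      refine measurableSet_le ?_ measurable_const
      have hc : Continuous fun x : Fin c0 → G → ℝ =>
          Real.sqrt (∑ k : Fin c0, ∑ g : G, (x k g) ^ 2) := by fun_prop
      exact hc.measurable.comp measurable_fst
    have h1 : ∀ᵐ p ∂μ, Real.sqrt (∑ k : Fin c0, ∑ g : G, (p.1 k g) ^ 2) ≤ bx :=
      (mem_ae_iff_prob_eq_one hset).2 hsupp
    have h2 := (measurePreserving_eval (fun _ : Fin m ⊕ Fin m => μ) i).quasiMeasurePreserving.ae h1
    filter_upwards [h2] with z hz
    exact (Real.sqrt_le_left hbx).1 hz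
  have hBad : ∀ N, (Measure.pi fun _ : Fin m => μ) (Bad N) ≤ ENNReal.ofReal δ := by
    intro N
    have hR : ∫ S, (⨆ k : Fin (N + 1), ∑ i, ((∫ p, f (q k) p ∂μ) - f (q k) (S i)))
        ∂(Measure.pi fun _ : Fin m => μ)
        ≤ 2 * (bx * M1 * M2) * Real.sqrt m + Real.sqrt (2 * m) := by
      refine symm_final μ m (fun k : Fin (N + 1) => f (q k)) (fun k => hfm _) (fun k => hfb _) _ ?_
      filter_upwards [hae] with z hz
      refine (rad_loss hℓlip (fun i (k : Fin (N + 1)) =>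
        gpoolNet σ φ ρ (q k).1.1 (q k).1.2 (z i).1) (fun i => (z i).2)).trans ?_
      refine (rad_net hc1 hσL hφL hρL hσh hφh hρh hM1 hM2
        (fun k : Fin (N + 1) => (q k).1.1) (fun k => (Real.sqrt_le_left hM1).1 (q k).2.1)
        (fun k : Fin (N + 1) => (q k).1.2) (fun k => (Real.sqrt_le_left hM2).1 (q k).2.2)
        (fun i => (z i).1) bx hz).trans (le_of_eq ?_)
      congr 1
      have : (2 : ℝ) * ((Fintype.card (Fin m ⊕ Fin m) : ℕ) * bx ^ 2) = (2 * bx) ^ 2 * m := by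
        simp; ring
      rw [this, Real.sqrt_mul (by positivity), Real.sqrt_sq (by positivity)]
      ring
    have h1 := finite_family_tail μ m hm (fun k : Fin (N + 1) => f (q k)) (fun k => hfm _)
      (fun k => hfb _) _ δ hδ0 hδ1 hR
    have h2 := final_arith m hm (bx * M1 * M2) δ hδ0 hδ1
    rw [← ENNReal.ofReal_toReal (measure_ne_top (Measure.pi fun _ : Fin m => μ) (Bad N))]
    refine ENNReal.ofReal_le_ofReal (le_trans (measureReal_mono ?_ (measure_ne_top _ _)) h1)
    rintro S ⟨k, hk⟩
    exact ⟨k, lt_of_le_of_lt h2 hk⟩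
  have hmono : Monotone Bad := by
    rintro N N' hN S ⟨k, hk⟩
    exact ⟨⟨k, by have := k.2; omega⟩, hk⟩
  have hUn : (Measure.pi fun _ : Fin m => μ) (⋃ N, Bad N) ≤ ENNReal.ofReal δ := by
    rw [hmono.measure_iUnion]
    exact iSup_le hBad
  have hmeas : MeasurableSet (⋃ N, Bad N) := by
    refine MeasurableSet.iUnion fun N => ?_
    have : Bad N = ⋃ k : Fin (N + 1),
        {S | m * bd < ∑ i, ((∫ z, f (q k) z ∂μ) - f (q k) (S i))} := by
      ext S; simp [Bad]
    rw [this]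
    refine MeasurableSet.iUnion fun k => measurableSet_lt measurable_const ?_
    have := hfm (q k)
    fun_prop
  have hgood : ENNReal.ofReal (1 - δ) ≤ (Measure.pi fun _ : Fin m => μ) (⋃ N, Bad N)ᶜ := by
    rw [prob_compl_eq_one_sub hmeas, ENNReal.ofReal_sub _ hδ0.le, ENNReal.ofReal_one]
    exact tsub_le_tsub_left hUn 1
  refine ge_iff_le.2 (hgood.trans (measure_mono ?_))
  intro S hS u w hu hw
  have hcl : IsClosed {p : P | ∑ i, ((∫ z, f p z ∂μ) - f p (S i)) ≤ m * bd} := by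
    refine isClosed_le ?_ continuous_const
    exact continuous_finsetSum _ fun i _ => hIc.sub (hfc (S i))
  have hall : ∀ p : P, ∑ i, ((∫ z, f p z ∂μ) - f p (S i)) ≤ m * bd := by
    intro p
    have hsub : Set.range q ⊆ {p : P | ∑ i, ((∫ z, f p z ∂μ) - f p (S i)) ≤ m * bd} := by
      rintro _ ⟨n, rfl⟩
      by_contra hc
      refine hS (Set.mem_iUnion.2 ⟨n, ⟨⟨n, Nat.lt_succ_self n⟩, ?_⟩⟩)
      exact not_le.1 hc
    have hd := (TopologicalSpace.denseRange_denseSeq P).closure_eq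
    have h3 := closure_minimal hsub hcl
    rw [hd] at h3
    exact h3 (Set.mem_univ p)
  have hfin := hall ⟨(u, w), hu, hw⟩
  rw [Finset.sum_sub_distrib] at hfin
  simp only [Finset.sum_const, Finset.card_univ, Fintype.card_fin, nsmul_eq_mul, f] at hfin
  rw [add_assoc, ← hbd]
  set A := ∫ p, ℓ (gpoolNet σ φ ρ u w p.1) p.2 ∂μ
  set T := ∑ i : Fin m, ℓ (gpoolNet σ φ ρ u w (S i).1) (S i).2
  refine le_of_mul_le_mul_left ?_ hm0
  have : (m : ℝ) * (1 / m * T + bd) = T + m * bd := by field_simp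
  rw [this]
  linarith
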